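/- Fix α ∈ (0, 1/2), δ ≥ 0, and σ > 0. Consider the problem of minimizing (c_l + c_u)·σ over pairs (c_l, c_u) ∈ ℝ² subject to the two constraints Φ(c_u + δ/σ) − Φ(−c_l) ≥ 1 − α and Φ(c_u) − Φ(−c_l − δ/σ) ≥ 1 − α. Then the pair (c_l, c_u) = (G(δ/σ), G(δ/σ)) is feasible, and it is the unique minimizer: every feasible pair (c_l, c_u) with (c_l + c_u)·σ ≤ 2·G(δ/σ)·σ satisfies (c_l, c_u) = (G(δ/σ), G(δ/σ)). -/

import Mathlib

open MeasureTheory ProbabilityTheory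

/-- The standard normal cumulative distribution function. -/
noncomputable def Phi (x : ℝ) : ℝ := (gaussianReal 0 1 (Set.Iic x)).toReal

theorem Phi_neg (x : ℝ) : Phi (-x) = 1 - Phi x := by
  have : NullSingletonClass (gaussianReal 0 1) := nullSingletonClass_gaussianReal one_ne_zero
  have hmap : (gaussianReal 0 1).map (fun y => -y) = gaussianReal 0 1 := by
    simpa using gaussianReal_map_neg (μ := 0) (v := 1)
  have hIci : gaussianReal 0 1 (Set.Iic (-x)) = gaussianReal 0 1 (Set.Ici x) := by
    nth_rewrite 1 [← hmap]
    rw [Measure.map_apply measurable_neg measurableSet_Iic]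
    congr 1
    ext y
    simp
  have hcompl : (gaussianReal 0 1).real (Set.Iic x)ᶜ = 1 - (gaussianReal 0 1).real (Set.Iic x) :=
    probReal_compl_eq_one_sub measurableSet_Iic
  rw [Set.compl_Iic] at hcompl
  rw [Phi, hIci, measure_congr Ioi_ae_eq_Ici.symm]
  exact hcompl

theorem Phi_zero : Phi 0 = 1 / 2 := by
  have h := Phi_neg 0
  rw [neg_zero] at h
  linarith

theorem continuous_gaussianPDFReal_zero_one : Continuous (gaussianPDFReal 0 1) := by
  unfold gaussianPDFReal
  fun_prop

theorem Phi_eq_setIntegral (x : ℝ) : Phi x = ∫ t in Set.Iic x, gaussianPDFReal 0 1 t := by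
  rw [Phi, gaussianReal_apply_eq_integral 0 one_ne_zero, ENNReal.toReal_ofReal]
  exact integral_nonneg fun t => gaussianPDFReal_nonneg 0 1 t

theorem hasDerivAt_Phi (x : ℝ) : HasDerivAt Phi (gaussianPDFReal 0 1 x) x := by
  have hint := integrable_gaussianPDFReal 0 1
  have heq : Phi = fun u => Phi 0 + ∫ t in (0 : ℝ)..u, gaussianPDFReal 0 1 t := by
    funext u
    rw [← intervalIntegral.integral_Iic_sub_Iic hint.integrableOn hint.integrableOn,
      ← Phi_eq_setIntegral, ← Phi_eq_setIntegral]
    ring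
  rw [heq]
  exact (continuous_gaussianPDFReal_zero_one.integral_hasStrictDerivAt 0 x).hasDerivAt.const_add _

theorem strictMono_Phi : StrictMono Phi :=
  strictMono_of_hasDerivAt_pos hasDerivAt_Phi fun x => gaussianPDFReal_pos 0 1 x one_ne_zero

theorem Phi_lt_one (x : ℝ) : Phi x < 1 := by
  have h : Phi (x + 1) ≤ 1 := measureReal_le_one
  exact (strictMono_Phi (lt_add_one x)).trans_le h

theorem gaussianPDFReal_zero_one_lt {a b : ℝ} (ha : 0 ≤ a) (hab : a < b) :
    gaussianPDFReal 0 1 b < gaussianPDFReal 0 1 a := by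
  unfold gaussianPDFReal
  have hsq : a ^ 2 < b ^ 2 := by gcongr
  refine mul_lt_mul_of_pos_left (Real.exp_lt_exp.2 ?_) (by positivity)
  simp only [sub_zero, NNReal.coe_one, mul_one]
  linarith

/-- On the nonnegative half-line, the increments of `Phi` of fixed length `t` are strictly
decreasing in the left end point. -/
theorem strictAntiOn_Phi_add_sub {t : ℝ} (ht : 0 < t) :
    StrictAntiOn (fun s => Phi (s + t) - Phi s) (Set.Ici 0) := by
  have hd (s : ℝ) : HasDerivAt (fun s => Phi (s + t) - Phi s)
      (gaussianPDFReal 0 1 (s + t) - gaussianPDFReal 0 1 s) s :=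
    ((hasDerivAt_Phi (s + t)).comp_add_const s t).sub (hasDerivAt_Phi s)
  refine strictAntiOn_of_deriv_neg (convex_Ici 0)
    (fun s _ => (hd s).continuousAt.continuousWithinAt) fun s hs => ?_
  rw [interior_Ici] at hs
  rw [(hd s).deriv]
  exact sub_neg.2 (gaussianPDFReal_zero_one_lt (le_of_lt hs) (by linarith))

theorem eq_of_Phi_add_Phi_le {a b g y : ℝ} (hy : 0 ≤ y) (ha : 0 ≤ a) (hab : a ≤ b)
    (hsum : a + b ≤ 2 * g) (h : Phi g + Phi (g + y) ≤ Phi a + Phi (b + y)) :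
    a = g ∧ b = g := by
  have hag : g ≤ a := by
    by_contra! hlt
    have hanti := strictAntiOn_Phi_add_sub (sub_pos.2 hlt) (Set.mem_Ici.2 ha)
      (Set.mem_Ici.2 (show 0 ≤ g + y by linarith)) (show a < g + y by linarith)
    have hmono : Phi (b + y) ≤ Phi (g + y + (g - a)) :=
      strictMono_Phi.monotone (by linarith)
    simp only [add_sub_cancel] at hanti
    linarith
  constructor <;> linarith

/-- For fixed `α ∈ (0, 1/2)`, `δ ≥ 0`, `σ > 0`, with `G` the function
assigning to each `y ≥ 0` the unique `c > 0` with `Φ(c + y) − Φ(−c) = 1 − α`: in the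
problem of minimizing `(c_l + c_u)σ` subject to `Φ(c_u + δ/σ) − Φ(−c_l) ≥ 1 − α` and
`Φ(c_u) − Φ(−c_l − δ/σ) ≥ 1 − α`, the pair `(G(δ/σ), G(δ/σ))` is feasible and is the
unique minimizer. -/
theorem critical_min_unique_solution
    (α : ℝ) (hα : 0 < α) (hα' : α < 1 / 2)
    (G : ℝ → ℝ)
    (hG : ∀ y : ℝ, 0 ≤ y → 0 < G y ∧ Phi (G y + y) - Phi (-(G y)) = 1 - α)
    (δ σ : ℝ) (hδ : 0 ≤ δ) (hσ : 0 < σ) :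
    (1 - α ≤ Phi (G (δ / σ) + δ / σ) - Phi (-(G (δ / σ))) ∧
      1 - α ≤ Phi (G (δ / σ)) - Phi (-(G (δ / σ)) - δ / σ)) ∧
    ∀ cl cu : ℝ,
      1 - α ≤ Phi (cu + δ / σ) - Phi (-cl) →
      1 - α ≤ Phi cu - Phi (-cl - δ / σ) →
      (cl + cu) * σ ≤ 2 * G (δ / σ) * σ →
      cl = G (δ / σ) ∧ cu = G (δ / σ) := by
  obtain ⟨hpos, heq⟩ := hG (δ / σ) (div_nonneg hδ hσ.le)
  have hy : 0 ≤ δ / σ := div_nonneg hδ hσ.le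
  generalize δ / σ = y at *
  generalize G y = g at *
  have hneg (x : ℝ) : Phi (-x - y) = 1 - Phi (x + y) := by
    rw [← Phi_neg, neg_add']
  simp only [hneg, Phi_neg] at *
  refine ⟨⟨heq.ge, by linarith⟩, fun cl cu h₁ h₂ hle => ?_⟩
  have hsum : cl + cu ≤ 2 * g := le_of_mul_le_mul_right hle hσ
  have hcl : 0 < cl := strictMono_Phi.lt_iff_lt.1 (by linarith [Phi_zero, Phi_lt_one (cu + y)])
  have hcu : 0 < cu := strictMono_Phi.lt_iff_lt.1 (by linarith [Phi_zero, Phi_lt_one (cl + y)])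
  rcases le_total cl cu with hc | hc
  · exact eq_of_Phi_add_Phi_le hy hcl.le hc hsum (by linarith)
  · exact (eq_of_Phi_add_Phi_le hy hcu.le hc (by linarith) (by linarith)).symm
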